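/- Let E be a generalized Banach space, S a nonempty bounded closed convex subset of E, and μ a monotone, regular, real, lower-additive generalized measure of noncompactness on E. Let F be a multivalued mapping on all of E with a closed graph whose values F(x) are nonempty closed convex subsets of E, and let G be a multivalued mapping on S with a closed graph whose values G(x) are nonempty subsets of E. Assume: (i) there exists a continuous nondecreasing function φ : [0,∞)ⁿ → [0,∞)ⁿ (componentwise order) with φᵐ(t) → 0 as m → ∞ for every t ∈ [0,∞)ⁿ, such that μ(F(V)) ≤ φ(μ(V)) componentwise for every bounded subset V of E; (ii) F(E) is bounded and G(S) is relatively compact; (iii) for every x ∈ S the set (I−F)⁻¹G(x) = {y ∈ E : ({y − u : u ∈ F(y)}) ∩ G(x) ≠ ∅} is convex; (iv) whenever x ∈ F(x) + G(y) for some y ∈ S, then x ∈ S. Then there exists x ∈ S with x ∈ F(x) + G(x). -/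

import Mathlib

open Filter Topology Set Bornology Pointwise
open scoped NNReal ENNReal

/-- A multivalued map `Q` on `S` has a closed graph: whenever `xₘ ∈ S`, `xₘ → a ∈ S`,
`yₘ ∈ Q xₘ` and `yₘ → b`, then `b ∈ Q a`. -/
def HasClosedGraphMV {E : Type*} [TopologicalSpace E] (S : Set E) (Q : E → Set E) : Prop :=
  ∀ (x y : ℕ → E) (a b : E), (∀ m, x m ∈ S) → a ∈ S →
    Tendsto x atTop (nhds a) → (∀ m, y m ∈ Q (x m)) → Tendsto y atTop (nhds b) → b ∈ Q a

section Scarf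

variable {Y ι : Type*} {β : Type*} [LinearOrder β]

/-- `σ` dominates with respect to the family `r` of orders: every `y` lies, for at least one
index, below all elements of `σ`. -/
def Dominates (r : ι → Y → β) (σ : Finset Y) : Prop :=
  ∀ y, ∃ i, ∀ a ∈ σ, r i y ≤ r i a

/-- A set of `|ι| - 1` dominating elements is contained in exactly two dominating sets of `|ι|`
elements, provided the regions on the other side of the colliding indices are never empty. -/
theorem Dominates.card_filter_insert_eq_two [Fintype ι] [Fintype Y] [DecidableEq Y]
    {r : ι → Y → β} (hr : ∀ i, Function.Injective (r i)) {τ : Finset Y} (hτ : Dominates r τ)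
    (hcard : τ.card + 1 = Fintype.card ι) (hne : τ.Nonempty)
    (hbig : ∀ k, ∃ y, ∀ l, l ≠ k → ∃ b ∈ τ, r l b < r l y)
    [DecidablePred fun x => x ∉ τ ∧ Dominates r (insert x τ)] :
    (Finset.univ.filter fun x => x ∉ τ ∧ Dominates r (insert x τ)).card = 2 := by
  classical
  choose m hmτ hm using fun l => τ.exists_min_image (r l) hne
  have hsurj : ∀ b ∈ τ, ∃ l, m l = b := fun b hb => by
    obtain ⟨l, hl⟩ := hτ b
    exact ⟨l, hr l (le_antisymm (hm l b hb) (hl _ (hmτ l)))⟩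
  obtain ⟨i, -, j, -, hij, hmij⟩ := Finset.exists_ne_map_eq_of_card_lt_of_maps_to
    (s := (Finset.univ : Finset ι)) (t := τ) (f := m)
    (by rw [Finset.card_univ]; omega) (fun l _ => hmτ l)
  have hex : ∀ k, ∃ x, (∀ l, l ≠ k → r l (m l) < r l x) ∧
      ∀ y, (∀ l, l ≠ k → r l (m l) < r l y) → r k y ≤ r k x := fun k => by
    obtain ⟨y, hy⟩ := hbig k
    obtain ⟨x, hx, hx'⟩ :=
      (Finset.univ.filter fun y => ∀ l, l ≠ k → r l (m l) < r l y).exists_max_image (r k) ⟨y, by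
        simp only [Finset.mem_filter, Finset.mem_univ, true_and]
        intro l hl
        obtain ⟨b, hb, hby⟩ := hy l hl
        exact (hm l b hb).trans_lt hby⟩
    simp only [Finset.mem_filter, Finset.mem_univ, true_and] at hx hx'
    exact ⟨x, hx, hx'⟩
  choose x hxM hxmax using hex
  have hxne : x i ≠ x j := fun h => by
    obtain ⟨l, hl⟩ := hτ (x i)
    have hl' := hl _ (hmτ l)
    by_cases hli : l = i
    · exact absurd (hxM j l (hli ▸ hij)) (not_lt.2 (h ▸ hl'))
    · exact absurd (hxM i l hli) (not_lt.2 hl')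
  have hgood : ∀ k k', k ≠ k' → m k = m k' → x k ∉ τ ∧ Dominates r (insert (x k) τ) := by
    intro k k' hkk hmk
    refine ⟨fun hmem => ?_, fun y => ?_⟩
    · obtain ⟨l, hl⟩ := hsurj _ hmem
      by_cases hlk : l = k
      · subst hlk
        have := hxM l k' hkk.symm
        rw [← hl, ← hmk] at this
        exact lt_irrefl _ this
      · have := hxM k l hlk
        rw [hl] at this
        exact lt_irrefl _ this
    · by_cases hy : ∀ l, l ≠ k → r l (m l) < r l y
      · obtain ⟨l, hl⟩ := hτ y
        have hlk : l = k := by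
          by_contra hlk
          exact absurd (hy l hlk) (not_lt.2 (hl _ (hmτ l)))
        subst hlk
        refine ⟨l, fun a ha => ?_⟩
        rcases Finset.mem_insert.1 ha with rfl | ha
        · exact hxmax l y hy
        · exact hl a ha
      · push Not at hy
        obtain ⟨l, hlk, hl⟩ := hy
        refine ⟨l, fun a ha => ?_⟩
        rcases Finset.mem_insert.1 ha with rfl | ha
        · exact hl.trans (hxM k l hlk).le
        · exact hl.trans (hm l a ha)
  have huniq : ∀ z, z ∉ τ → Dominates r (insert z τ) → z = x i ∨ z = x j := by
    intro z hz hdom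
    choose c hcσ hc using fun l => (insert z τ).exists_min_image (r l) ⟨z, by simp⟩
    have hcsurj : ∀ b ∈ insert z τ, ∃ l, c l = b := fun b hb => by
      obtain ⟨l, hl⟩ := hdom b
      exact ⟨l, hr l (le_antisymm (hc l b hb) (hl _ (hcσ l)))⟩
    have hcinj : Function.Injective c := by
      have h1 : Finset.univ.image c = insert z τ := by
        ext b
        simp only [Finset.mem_image, Finset.mem_univ, true_and]
        exact ⟨by rintro ⟨l, rfl⟩; exact hcσ l, hcsurj b⟩
      rw [← Set.injOn_univ, ← Finset.coe_univ, ← Finset.card_image_iff, h1,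
        Finset.card_insert_of_notMem hz, hcard, Finset.card_univ]
    obtain ⟨k, hk⟩ := hcsurj z (by simp)
    have hcm : ∀ l, l ≠ k → c l = m l ∧ r l (m l) < r l z := fun l hl => by
      have h1 : c l ≠ z := fun h => hl (hcinj (h.trans hk.symm))
      have h2 : c l ∈ τ := (Finset.mem_insert.1 (hcσ l)).resolve_left h1
      have h3 : c l = m l :=
        hr l (le_antisymm (hc l _ (Finset.mem_insert_of_mem (hmτ l))) (hm l _ h2))
      refine ⟨h3, lt_of_le_of_ne (h3 ▸ hc l z (by simp)) fun h => h1 (h3.trans (hr l h))⟩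
    have hzmax : z = x k := by
      refine hr k (le_antisymm (hxmax k z fun l hl => (hcm l hl).2) ?_)
      obtain ⟨l, hl⟩ := hdom (x k)
      by_cases hlk : l = k
      · subst hlk
        exact hl z (by simp)
      · exact absurd (hxM k l hlk) (not_lt.2 (hl _ (Finset.mem_insert_of_mem (hmτ l))))
    by_cases hki : k = i
    · exact Or.inl (hki ▸ hzmax)
    by_cases hkj : k = j
    · exact Or.inr (hkj ▸ hzmax)
    exact absurd (hcinj ((hcm i (Ne.symm hki)).1.trans
      (hmij.trans (hcm j (Ne.symm hkj)).1.symm))) hij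
  rw [Finset.card_eq_two]
  refine ⟨x i, x j, hxne, ?_⟩
  ext z
  simp only [Finset.mem_filter, Finset.mem_univ, true_and, Finset.mem_insert,
    Finset.mem_singleton]
  refine ⟨fun h => huniq z h.1 h.2, ?_⟩
  rintro (rfl | rfl)
  · exact hgood i j hij hmij
  · exact hgood j i hij.symm hmij.symm

/-- A set `σ` of `|ι|` labelled elements has an even number of facets carrying exactly the labels
other than `i₀`, unless it carries all labels. -/
theorem even_card_filter_image_erase [Fintype ι] [DecidableEq ι] [DecidableEq Y]
    (lab : Y → ι) (i₀ : ι) {σ : Finset Y} (hcard : σ.card = Fintype.card ι)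
    (hσ : σ.image lab ≠ Finset.univ) :
    Even (σ.filter fun x => (σ.erase x).image lab = Finset.univ.erase i₀).card := by
  classical
  rcases Finset.eq_empty_or_nonempty
    (σ.filter fun x => (σ.erase x).image lab = Finset.univ.erase i₀) with h | ⟨x, hx⟩
  · simp [h]
  obtain ⟨hxσ, hx⟩ := Finset.mem_filter.1 hx
  have hinj : Set.InjOn lab (σ.erase x : Finset Y) := by
    rw [← Finset.card_image_iff, hx, Finset.card_erase_of_mem (Finset.mem_univ _),
      Finset.card_erase_of_mem hxσ, hcard, Finset.card_univ]
  have hlx : lab x ≠ i₀ := fun h => hσ <| by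
    rw [← Finset.insert_erase hxσ, Finset.image_insert, hx, h,
      Finset.insert_erase (Finset.mem_univ _)]
  obtain ⟨y, hy, hyx⟩ : ∃ y ∈ σ.erase x, lab y = lab x := by
    rw [← Finset.mem_image, hx]
    simpa using hlx
  have hyσ := Finset.mem_of_mem_erase hy
  have hyne := Finset.ne_of_mem_erase hy
  have himg : (σ.erase y).image lab = Finset.univ.erase i₀ := by
    rw [← hx]
    apply Finset.Subset.antisymm <;> intro c hc <;> obtain ⟨z, hz, rfl⟩ := Finset.mem_image.1 hc
    · by_cases hzx : z = x
      · exact Finset.mem_image.2 ⟨y, hy, hzx ▸ hyx⟩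
      · exact Finset.mem_image_of_mem _ (Finset.mem_erase.2 ⟨hzx, Finset.mem_of_mem_erase hz⟩)
    · by_cases hzy : z = y
      · exact Finset.mem_image.2 ⟨x, Finset.mem_erase.2 ⟨hyne.symm, hxσ⟩, hzy ▸ hyx.symm⟩
      · exact Finset.mem_image_of_mem _ (Finset.mem_erase.2 ⟨hzy, Finset.mem_of_mem_erase hz⟩)
  have : (σ.filter fun x => (σ.erase x).image lab = Finset.univ.erase i₀) = {x, y} := by
    ext z
    simp only [Finset.mem_filter, Finset.mem_insert, Finset.mem_singleton]
    constructor
    · rintro ⟨hzσ, hz⟩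
      by_contra! hne
      have hzx : z ∈ σ.erase x := Finset.mem_erase.2 ⟨hne.1, hzσ⟩
      have hmem : lab z ∈ (σ.erase z).image lab := by
        rw [hz, ← hx]; exact Finset.mem_image_of_mem _ hzx
      obtain ⟨w, hw, hwz⟩ := Finset.mem_image.1 hmem
      by_cases hwx : w = x
      · refine hne.2 (hinj hzx hy ?_)
        rw [hyx, ← hwz, hwx]
      · exact Finset.ne_of_mem_erase hw
          (hinj (Finset.mem_erase.2 ⟨hwx, Finset.mem_of_mem_erase hw⟩) hzx hwz)
    · rintro (rfl | rfl)
      exacts [⟨hxσ, hx⟩, ⟨hyσ, himg⟩]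
  rw [this, Finset.card_pair hyne.symm]
  exact even_two

/-- **Scarf's lemma**, with slack elements `s i` that are least for the order `i` and lie above
all ordinary elements for the other orders. -/
theorem exists_dominates_image_eq_univ [Fintype ι] [DecidableEq ι] [Nonempty ι]
    [Fintype Y] [DecidableEq Y]
    {r : ι → Y → β} (hr : ∀ i, Function.Injective (r i)) (s : ι → Y)
    (hs_inj : Function.Injective s)
    (hs_bot : ∀ i y, r i (s i) ≤ r i y)
    (hs_top : ∀ i j y, i ≠ j → y ∉ range s → r i y < r i (s j))
    (hY : ∃ y, y ∉ range s) (lab : Y → ι) (hlab : ∀ i, lab (s i) = i) :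
    ∃ σ : Finset Y, Dominates r σ ∧ σ.image lab = Finset.univ := by
  classical
  obtain ⟨i₀⟩ := ‹Nonempty ι›
  by_contra! hno
  let rooms : Finset (Finset Y) :=
    Finset.univ.filter fun σ => Dominates r σ ∧ σ.card = Fintype.card ι
  let doors : Finset (Finset Y) :=
    Finset.univ.filter fun τ => Dominates r τ ∧ τ.card + 1 = Fintype.card ι ∧
      τ.image lab = Finset.univ.erase i₀
  have hcount := Finset.sum_card_bipartiteAbove_eq_sum_card_bipartiteBelow
    (s := rooms) (t := doors) (fun σ τ => τ ⊆ σ)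
  have hleft : Even (∑ σ ∈ rooms, (doors.bipartiteAbove (fun σ τ => τ ⊆ σ) σ).card) := by
    refine Finset.even_sum _ fun σ hσ => ?_
    obtain ⟨-, hdom, hcard⟩ := Finset.mem_filter.1 hσ
    have key : doors.bipartiteAbove (fun σ τ => τ ⊆ σ) σ =
        (σ.filter fun x => (σ.erase x).image lab = Finset.univ.erase i₀).image σ.erase := by
      ext τ
      simp only [Finset.mem_bipartiteAbove, Finset.mem_image, doors, Finset.mem_filter,
        Finset.mem_univ, true_and]
      constructor
      · rintro ⟨⟨-, hτc, hτl⟩, hτσ⟩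
        have h1 : (σ \ τ).card = 1 := by
          rw [Finset.card_sdiff_of_subset hτσ]; omega
        obtain ⟨x, hx⟩ := Finset.card_eq_one.1 h1
        have hxσ : x ∈ σ \ τ := by simp [hx]
        have hτ : σ.erase x = τ := by
          rw [← Finset.sdiff_singleton_eq_erase, ← hx, Finset.sdiff_sdiff_eq_self hτσ]
        exact ⟨x, ⟨(Finset.mem_sdiff.1 hxσ).1, hτ ▸ hτl⟩, hτ⟩
      · rintro ⟨x, ⟨hxσ, hx⟩, rfl⟩
        refine ⟨⟨fun y => ?_, ?_, hx⟩, Finset.erase_subset _ _⟩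
        · obtain ⟨i, hi⟩ := hdom y
          exact ⟨i, fun a ha => hi a (Finset.mem_of_mem_erase ha)⟩
        · rw [Finset.card_erase_add_one hxσ, hcard]
    rw [key, Finset.card_image_of_injOn]
    · exact even_card_filter_image_erase lab i₀ hcard (hno σ hdom)
    · exact (Finset.erase_injOn σ).mono fun x hx => (Finset.mem_filter.1 hx).1
  have hbelow : ∀ τ ∈ doors, (rooms.bipartiteBelow (fun σ τ => τ ⊆ σ) τ).card =
      (Finset.univ.filter fun x => x ∉ τ ∧ Dominates r (insert x τ)).card := by
    intro τ hτ
    obtain ⟨-, hdom, hcard, himg⟩ := Finset.mem_filter.1 hτ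
    have key : rooms.bipartiteBelow (fun σ τ => τ ⊆ σ) τ =
        (Finset.univ.filter fun x => x ∉ τ ∧ Dominates r (insert x τ)).image
          fun x => insert x τ := by
      ext σ
      simp only [Finset.mem_bipartiteBelow, Finset.mem_image, rooms, Finset.mem_filter,
        Finset.mem_univ, true_and]
      constructor
      · rintro ⟨⟨hσd, hσc⟩, hτσ⟩
        have h1 : (σ \ τ).card = 1 := by
          rw [Finset.card_sdiff_of_subset hτσ]; omega
        obtain ⟨x, hx⟩ := Finset.card_eq_one.1 h1
        have hxσ : x ∈ σ \ τ := by simp [hx]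
        have hτ : insert x τ = σ := by
          rw [Finset.insert_eq, ← hx, Finset.sdiff_union_of_subset hτσ]
        exact ⟨x, ⟨(Finset.mem_sdiff.1 hxσ).2, hτ ▸ hσd⟩, hτ⟩
      · rintro ⟨x, ⟨hxτ, hx⟩, rfl⟩
        exact ⟨⟨hx, by rw [Finset.card_insert_of_notMem hxτ, hcard]⟩, Finset.subset_insert _ _⟩
    rw [key, Finset.card_image_of_injOn]
    intro x hx y hy hxy
    have hxτ : x ∉ τ := (Finset.mem_filter.1 hx).2.1
    have : x ∈ insert y τ := by
      rw [← show insert x τ = insert y τ from hxy]; exact Finset.mem_insert_self _ _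
    exact (Finset.mem_insert.1 this).resolve_right hxτ
  let τ₀ : Finset Y := (Finset.univ.erase i₀).image s
  have hmem₀ : ∀ j, j ≠ i₀ → s j ∈ τ₀ := fun j hj =>
    Finset.mem_image_of_mem _ (Finset.mem_erase.2 ⟨hj, Finset.mem_univ _⟩)
  have hof₀ : ∀ y ∈ τ₀, ∃ j, j ≠ i₀ ∧ s j = y := fun y hy => by
    obtain ⟨j, hj, rfl⟩ := Finset.mem_image.1 hy
    exact ⟨j, Finset.ne_of_mem_erase hj, rfl⟩
  have hins₀ : ∀ x, x ∉ range s → (∀ y, y ∉ range s → r i₀ y ≤ r i₀ x) →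
      Dominates r (insert x τ₀) := by
    intro x hx hmax y
    by_cases hy : y ∈ range s
    · obtain ⟨j, rfl⟩ := hy
      exact ⟨j, fun a _ => hs_bot j a⟩
    · refine ⟨i₀, fun a ha => ?_⟩
      rcases Finset.mem_insert.1 ha with rfl | ha
      · exact hmax y hy
      · obtain ⟨j, hj, rfl⟩ := hof₀ a ha
        exact (hs_top i₀ j y hj.symm hy).le
  obtain ⟨x₀, hx₀, hx₀max⟩ : ∃ x, x ∉ range s ∧ ∀ y, y ∉ range s → r i₀ y ≤ r i₀ x := by
    obtain ⟨y, hy⟩ := hY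
    obtain ⟨x, hx, hx'⟩ := (Finset.univ.filter fun y => y ∉ range s).exists_max_image (r i₀)
      ⟨y, Finset.mem_filter.2 ⟨Finset.mem_univ _, hy⟩⟩
    exact ⟨x, (Finset.mem_filter.1 hx).2,
      fun y hy => hx' y (Finset.mem_filter.2 ⟨Finset.mem_univ _, hy⟩)⟩
  have hτ₀ : τ₀ ∈ doors := by
    refine Finset.mem_filter.2 ⟨Finset.mem_univ _, fun y => ?_, ?_, ?_⟩
    · obtain ⟨i, hi⟩ := hins₀ x₀ hx₀ hx₀max y
      exact ⟨i, fun a ha => hi a (Finset.mem_insert_of_mem ha)⟩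
    · rw [Finset.card_image_of_injective _ hs_inj,
        Finset.card_erase_add_one (Finset.mem_univ _), Finset.card_univ]
    · rw [Finset.image_image]
      rw [show lab ∘ s = id from funext hlab, Finset.image_id]
  have hone : (Finset.univ.filter fun x => x ∉ τ₀ ∧ Dominates r (insert x τ₀)).card = 1 := by
    rw [Finset.card_eq_one]
    refine ⟨x₀, ?_⟩
    ext x
    simp only [Finset.mem_filter, Finset.mem_univ, true_and, Finset.mem_singleton]
    constructor
    · rintro ⟨hx, hdom⟩
      have hlow : ∀ y, y ∉ range s → r i₀ y ≤ r i₀ x := fun y hy => by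
        obtain ⟨i, hi⟩ := hdom y
        by_cases hii : i = i₀
        · exact hii ▸ hi x (Finset.mem_insert_self _ _)
        · exact absurd ⟨i, hr i (le_antisymm (hs_bot i y)
            (hi _ (Finset.mem_insert_of_mem (hmem₀ i hii))))⟩ hy
      have hxr : x ∉ range s := by
        rintro ⟨j, rfl⟩
        have hj : j = i₀ := by
          by_contra hj
          exact hx (hmem₀ j hj)
        exact hx₀ ⟨j, hr i₀ (le_antisymm (hj ▸ hs_bot j x₀) (hlow x₀ hx₀))⟩
      exact hr i₀ (le_antisymm (hx₀max x hxr) (hlow x₀ hx₀))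
    · rintro rfl
      refine ⟨fun h => ?_, hins₀ x hx₀ hx₀max⟩
      obtain ⟨j, -, hj⟩ := hof₀ x h
      exact hx₀ ⟨j, hj⟩
  have htwo : ∀ τ ∈ doors.erase τ₀,
      Even (rooms.bipartiteBelow (fun σ τ => τ ⊆ σ) τ).card := by
    intro τ hτ
    obtain ⟨hne, hτ⟩ := Finset.mem_erase.1 hτ
    rw [hbelow τ hτ]
    obtain ⟨-, hdom, hcard, himg⟩ := Finset.mem_filter.1 hτ
    obtain ⟨b, hb, hbs⟩ : ∃ b ∈ τ, b ∉ range s := by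
      by_contra! hall
      refine hne (Finset.eq_of_subset_of_card_le (fun y hy => ?_) ?_)
      · obtain ⟨j, rfl⟩ := hall y hy
        refine hmem₀ j ?_
        have : lab (s j) ∈ Finset.univ.erase i₀ := himg ▸ Finset.mem_image_of_mem _ hy
        rw [hlab] at this
        exact Finset.ne_of_mem_erase this
      · have := (Finset.mem_filter.1 hτ₀).2.2.1
        omega
    rw [hdom.card_filter_insert_eq_two hr hcard ⟨b, hb⟩
      fun k => ⟨s k, fun l hl => ⟨b, hb, hs_top l k b hl hbs⟩⟩]
    exact even_two
  have hright : Odd (∑ τ ∈ doors, (rooms.bipartiteBelow (fun σ τ => τ ⊆ σ) τ).card) := by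
    rw [← Finset.add_sum_erase _ _ hτ₀, hbelow τ₀ hτ₀, hone]
    exact odd_one.add_even (Finset.even_sum _ htwo)
  rw [hcount] at hleft
  exact (Nat.not_even_iff_odd.2 hright) hleft

/-- **Scarf's lemma** for a finite set `X` with coordinates `p` and a labelling `lab`. -/
theorem exists_finset_dominating_labelled [Fintype ι] [Nonempty ι] {X : Type*} [Fintype X]
    [Nonempty X] {α : Type*} [LinearOrder α] (p : X → ι → α) (lab : X → ι) :
    ∃ (A : Finset X) (C : Finset ι), (∀ y, ∃ i ∈ C, ∀ a ∈ A, p y i ≤ p a i) ∧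
      ∀ i ∈ C, ∃ a ∈ A, lab a = i := by
  classical
  let q : ι → X ⊕ ι → WithBot (WithTop α) := fun i y =>
    y.elim (fun x => ((p x i : WithTop α) : WithBot (WithTop α)))
      fun j => if i = j then ⊥ else ((⊤ : WithTop α) : WithBot (WithTop α))
  let e := Fintype.equivFin (X ⊕ ι)
  let r : ι → X ⊕ ι → WithBot (WithTop α) ×ₗ Fin (Fintype.card (X ⊕ ι)) :=
    fun i y => toLex (q i y, e y)
  have hlt : ∀ i y z, q i y < q i z → r i y < r i z := fun i y z h =>
    Prod.Lex.toLex_lt_toLex.2 (Or.inl h)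
  have hle : ∀ i y z, r i y ≤ r i z → q i y ≤ q i z := fun i y z h => by
    by_contra! h'
    exact absurd (hlt i z y h') (not_lt.2 h)
  have hinr : ∀ y : X ⊕ ι, y ∉ range (Sum.inr : ι → X ⊕ ι) → ∃ x, y = Sum.inl x := by
    rintro (x | j) h
    exacts [⟨x, rfl⟩, absurd ⟨j, rfl⟩ h]
  have hbot : ∀ i y, y ≠ Sum.inr i → r i (Sum.inr i) < r i y := by
    rintro i (x | j) hy
    · exact hlt _ _ _ (by simp [q])
    · refine hlt _ _ _ ?_
      have : i ≠ j := fun h => hy (h ▸ rfl)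
      simp [q, this]
  obtain ⟨σ, hdom, himg⟩ := exists_dominates_image_eq_univ (r := r)
    (fun i y z h => e.injective (congrArg (fun t => (ofLex t).2) h)) Sum.inr Sum.inr_injective
    (fun i y => by
      by_cases hy : y = Sum.inr i
      · rw [hy]
      · exact (hbot i y hy).le)
    (fun i j y hij hy => by
      obtain ⟨x, rfl⟩ := hinr y hy
      refine hlt _ _ _ ?_
      simp only [q, Sum.elim_inl, Sum.elim_inr, if_neg hij]
      exact WithBot.coe_lt_coe.2 (WithTop.coe_lt_top _))
    ⟨Sum.inl (Classical.arbitrary X), by simp⟩ (Sum.elim lab id) (fun i => rfl)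
  refine ⟨Finset.univ.filter fun x => Sum.inl x ∈ σ, Finset.univ.filter fun i => Sum.inr i ∉ σ,
    fun y => ?_, fun i hi => ?_⟩
  · obtain ⟨i, hi⟩ := hdom (Sum.inl y)
    refine ⟨i, Finset.mem_filter.2 ⟨Finset.mem_univ _, fun h => ?_⟩, fun a ha => ?_⟩
    · exact absurd (hbot i (Sum.inl y) (by simp)) (not_lt.2 (hi _ h))
    · have := hle _ _ _ (hi _ (Finset.mem_filter.1 ha).2)
      simpa [q] using this
  · have hi' : Sum.inr i ∉ σ := (Finset.mem_filter.1 hi).2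
    obtain ⟨y, hy, hyi⟩ := Finset.mem_image.1 (himg.symm ▸ Finset.mem_univ i)
    rcases y with x | j
    · exact ⟨x, Finset.mem_filter.2 ⟨Finset.mem_univ _, hy⟩, hyi⟩
    · simp only [Sum.elim_inr, id] at hyi
      exact absurd (hyi ▸ hy) hi'

end Scarf

section Brouwer

variable {ι : Type*} [Fintype ι]

/-- A family of lattice points of the dilated simplex which dominates all lattice points has
bounded diameter, and its coordinates outside the index set are bounded. -/
theorem lattice_dominating_bounds {N : ℕ} {A : Finset (ι → ℕ)} {C : Finset ι}
    (hA : ∀ a ∈ A, ∑ i, a i = N)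
    (hdom : ∀ y : ι → ℕ, ∑ i, y i = N → ∃ i ∈ C, ∀ a ∈ A, y i ≤ a i) {a : ι → ℕ} (ha : a ∈ A) :
    (∀ b ∈ A, ∀ j, a j ≤ b j + Fintype.card ι) ∧ ∀ j ∉ C, a j ≤ Fintype.card ι := by
  classical
  choose v hvA hv using fun j => A.exists_min_image (fun a => a j) ⟨a, ha⟩
  let m : ι → ℕ := fun j => if j ∈ C then v j j else 0
  have hm : ∀ b ∈ A, ∀ j, m j ≤ b j := fun b hb j => by
    by_cases hj : j ∈ C
    · simpa [m, hj] using hv j b hb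
    · simp [m, hj]
  obtain ⟨i₀, hi₀, -⟩ := hdom a (hA a ha)
  have hsum : N < ∑ j, m j + Fintype.card ι := by
    by_contra! hle
    obtain ⟨i, hi, h⟩ := hdom
      (fun j => (m j + 1) + if j = i₀ then N - (∑ j, m j + Fintype.card ι) else 0) (by
        rw [Finset.sum_add_distrib, Finset.sum_add_distrib, Finset.sum_ite_eq' Finset.univ i₀]
        simp only [Finset.sum_const, Finset.card_univ, Finset.mem_univ, if_true, smul_eq_mul,
          mul_one]
        omega)
    have := h _ (hvA i)
    simp only [m, hi, if_true] at this
    omega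
  have hmain : ∀ j, a j ≤ m j + Fintype.card ι := fun j => by
    have h1 := Finset.add_sum_erase Finset.univ a (Finset.mem_univ j)
    have h2 := Finset.add_sum_erase Finset.univ m (Finset.mem_univ j)
    have h3 : ∑ i ∈ Finset.univ.erase j, m i ≤ ∑ i ∈ Finset.univ.erase j, a i :=
      Finset.sum_le_sum fun i _ => hm a ha i
    have h4 := hA a ha
    omega
  refine ⟨fun b hb j => (hmain j).trans (by have := hm b hb j; omega), fun j hj => ?_⟩
  simpa [m, hj] using hmain j

/-- Every self-map of the simplex has points near which each coordinate is small or fails to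
decrease somewhere. -/
theorem exists_approx_le_stdSimplex [Nonempty ι] {f : (ι → ℝ) → ι → ℝ}
    (hf : MapsTo f (stdSimplex ℝ ι) (stdSimplex ℝ ι)) (N : ℕ) :
    ∃ x ∈ stdSimplex ℝ ι, ∀ i, x i ≤ Fintype.card ι / (N + 1 : ℝ) ∨
      ∃ b ∈ stdSimplex ℝ ι, dist b x ≤ Fintype.card ι / (N + 1 : ℝ) ∧ b i ≤ f b i := by
  classical
  let X := ↥(Finset.piAntidiag (Finset.univ : Finset ι) (N + 1))
  have : Fintype X := Finset.fintypeCoeSort _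
  have hX : ∀ x : X, ∑ i, x.1 i = N + 1 := fun x => (Finset.mem_piAntidiag.1 x.2).1
  have hXof : ∀ y : ι → ℕ, ∑ i, y i = N + 1 →
      y ∈ Finset.piAntidiag Finset.univ (N + 1) := fun y hy =>
    Finset.mem_piAntidiag.2 ⟨hy, fun i _ => Finset.mem_univ i⟩
  have : Nonempty X := ⟨⟨Pi.single (Classical.arbitrary ι) (N + 1), hXof _ (by simp)⟩⟩
  have hN : (0 : ℝ) < N + 1 := by positivity
  let pt : X → ι → ℝ := fun x i => x.1 i / (N + 1 : ℝ)
  have hpt : ∀ x, pt x ∈ stdSimplex ℝ ι := fun x => by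
    refine ⟨fun i => by positivity, ?_⟩
    simp only [pt]
    rw [← Finset.sum_div, div_eq_one_iff_eq hN.ne']
    exact_mod_cast hX x
  have hlab : ∀ x, ∃ i, pt x i ≤ f (pt x) i := fun x => by
    by_contra! h
    have := Finset.sum_lt_sum_of_nonempty Finset.univ_nonempty fun i _ => h i
    rw [(hf (hpt x)).2, (hpt x).2] at this
    exact lt_irrefl _ this
  choose lab hlab using hlab
  obtain ⟨A, C, hdom, hC⟩ := exists_finset_dominating_labelled (fun x : X => x.1) lab
  obtain ⟨i₀, hi₀, -⟩ := hdom (Classical.arbitrary X)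
  obtain ⟨a, ha, -⟩ := hC i₀ hi₀
  have hb := fun x (hx : x ∈ A) => lattice_dominating_bounds (N := N + 1)
    (A := A.image Subtype.val) (C := C) (a := x.1)
    (by
      intro y hy
      obtain ⟨z, -, rfl⟩ := Finset.mem_image.1 hy
      exact hX z)
    (fun y hy => by
      obtain ⟨i, hi, h⟩ := hdom ⟨y, hXof y hy⟩
      refine ⟨i, hi, fun z hz => ?_⟩
      obtain ⟨w, hw, rfl⟩ := Finset.mem_image.1 hz
      exact h w hw) (Finset.mem_image_of_mem _ hx)
  refine ⟨pt a, hpt a, fun i => ?_⟩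
  by_cases hi : i ∈ C
  · obtain ⟨b, hbA, hbi⟩ := hC i hi
    refine Or.inr ⟨pt b, hpt b, ?_, hbi ▸ hlab b⟩
    refine (dist_pi_le_iff (by positivity)).2 fun j => ?_
    have h1 : (a.1 j : ℝ) ≤ b.1 j + Fintype.card ι := by
      exact_mod_cast (hb a ha).1 _ (Finset.mem_image_of_mem _ hbA) j
    have h2 : (b.1 j : ℝ) ≤ a.1 j + Fintype.card ι := by
      exact_mod_cast (hb b hbA).1 _ (Finset.mem_image_of_mem _ ha) j
    rw [Real.dist_eq, ← sub_div, abs_div, abs_of_pos hN]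
    gcongr
    rw [abs_le]
    constructor <;> linarith
  · left
    have h1 : (a.1 i : ℝ) ≤ Fintype.card ι := by exact_mod_cast (hb a ha).2 i hi
    simp only [pt]
    gcongr

/-- **Brouwer's fixed point theorem** on the standard simplex. -/
theorem exists_fixedPoint_stdSimplex [Nonempty ι] {f : (ι → ℝ) → ι → ℝ}
    (hf : MapsTo f (stdSimplex ℝ ι) (stdSimplex ℝ ι)) (hc : ContinuousOn f (stdSimplex ℝ ι)) :
    ∃ x ∈ stdSimplex ℝ ι, f x = x := by
  choose x hx hxi using exists_approx_le_stdSimplex hf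
  obtain ⟨z, hz, ψ, hψ, hlim⟩ := (isCompact_stdSimplex ℝ ι).tendsto_subseq hx
  have hsmall : Tendsto (fun m => (Fintype.card ι : ℝ) / ((ψ m : ℕ) + 1 : ℝ)) atTop (𝓝 0) :=
    (tendsto_const_div_atTop_nhds_zero_nat (Fintype.card ι : ℝ)).comp
      ((tendsto_add_atTop_nat 1).comp hψ.tendsto_atTop) |>.congr fun m => by simp
  have hle : ∀ i, z i ≤ f z i := fun i => by
    by_contra! hlt
    have hpos : 0 < z i := ((hf hz).1 i).trans_lt hlt
    have hev : ∀ᶠ b in 𝓝[stdSimplex ℝ ι] z, f b i < b i :=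
      Tendsto.eventually_lt (((continuous_apply i).continuousAt.comp_continuousWithinAt (hc z hz)))
        ((continuous_apply i).continuousWithinAt) hlt
    obtain ⟨δ, hδ, hball⟩ := Metric.mem_nhdsWithin_iff.1 hev
    have hη : 0 < min δ (z i) / 2 := by positivity
    obtain ⟨m, hm1, hm2⟩ := ((hsmall.eventually_lt_const hη).and
      (hlim.eventually (Metric.ball_mem_nhds z hη))).exists
    have hm2 : dist (x (ψ m)) z < min δ (z i) / 2 := hm2
    have h1 := min_le_left δ (z i)
    have h2 := min_le_right δ (z i)
    rcases hxi (ψ m) i with h | ⟨b, hb, hbx, hbi⟩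
    · have h3 := (dist_le_pi_dist (x (ψ m)) z i).trans_lt hm2
      rw [Real.dist_eq] at h3
      have := abs_lt.1 h3
      linarith
    · have h3 : dist b z < δ := by
        have := dist_triangle b (x (ψ m)) z
        linarith
      exact absurd hbi (not_le.2 (hball ⟨h3, hb⟩))
  refine ⟨z, hz, ?_⟩
  have heq := (Finset.sum_eq_sum_iff_of_le fun i _ => hle i).1 (hz.2.trans (hf hz).2.symm)
  exact funext fun i => (heq i (Finset.mem_univ i)).symm

end Brouwer

section Kakutani

variable {E : Type*} [NormedAddCommGroup E] [NormedSpace ℝ E]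

/-- A multivalued self-map of a compact convex set has approximate fixed points. -/
theorem exists_mem_convexHull_biUnion_ball {K : Set E} (hK : IsCompact K) (hKc : Convex ℝ K)
    (hKne : K.Nonempty) {T : E → Set E} (hT : ∀ x ∈ K, (T x).Nonempty) (hTK : ∀ x ∈ K, T x ⊆ K)
    {ε : ℝ} (hε : 0 < ε) :
    ∃ x ∈ K, x ∈ convexHull ℝ (⋃ z ∈ K ∩ Metric.ball x ε, T z) := by
  classical
  obtain ⟨t, htK, htfin, ht⟩ := hK.finite_cover_balls hε
  have := htfin.fintype
  obtain ⟨x₀, hx₀⟩ := hKne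
  obtain ⟨c₀, hc₀, -⟩ := mem_iUnion₂.1 (ht hx₀)
  have : Nonempty t := ⟨⟨c₀, hc₀⟩⟩
  choose y hy using fun c : t => hT c (htK c.2)
  have hyK : ∀ c, y c ∈ K := fun c => hTK c (htK c.2) (hy c)
  let g : t → E → ℝ := fun c x => max 0 (ε - dist x c)
  have hg0 : ∀ c x, 0 ≤ g c x := fun c x => le_max_left _ _
  have hgc : ∀ c, Continuous (g c) := fun c => by fun_prop
  have hgpos : ∀ x ∈ K, 0 < ∑ c, g c x := fun x hx => by
    obtain ⟨c, hc, hxc⟩ := mem_iUnion₂.1 (ht hx)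
    refine Finset.sum_pos' (fun c _ => hg0 c x) ⟨⟨c, hc⟩, Finset.mem_univ _, ?_⟩
    exact lt_max_of_lt_right (sub_pos.2 hxc)
  let comb : (t → ℝ) → E := fun w => ∑ c, w c • y c
  have hcombK : ∀ w ∈ stdSimplex ℝ t, comb w ∈ K := fun w hw =>
    hKc.sum_mem (fun c _ => hw.1 c) hw.2 fun c _ => hyK c
  have hcombc : Continuous comb := by fun_prop
  obtain ⟨w, hw, hfix⟩ := exists_fixedPoint_stdSimplex
    (f := fun w c => g c (comb w) / ∑ d, g d (comb w))
    (fun w hw => ⟨fun c => div_nonneg (hg0 _ _) (hgpos _ (hcombK w hw)).le, by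
      rw [← Finset.sum_div, div_self (hgpos _ (hcombK w hw)).ne']⟩)
    (continuousOn_pi.2 fun c => ContinuousOn.div ((hgc c).comp hcombc).continuousOn
      (continuous_finsetSum _ fun d _ => (hgc d).comp hcombc).continuousOn
      fun w hw => (hgpos _ (hcombK w hw)).ne')
  refine ⟨comb w, hcombK w hw, ?_⟩
  set U := ⋃ z ∈ K ∩ Metric.ball (comb w) ε, T z
  have hsupp : ∀ c, w c ≠ 0 → y c ∈ U := fun c hc => by
    refine mem_iUnion₂.2 ⟨c, ⟨htK c.2, ?_⟩, hy c⟩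
    rw [← congrFun hfix c] at hc
    have hgne : g c (comb w) ≠ 0 := fun h => hc (by simp [h])
    rw [Metric.mem_ball, dist_comm]
    by_contra! hle
    exact hgne (max_eq_left (by linarith))
  rw [show comb w = ∑ c ∈ Finset.univ.filter fun c => w c ≠ 0, w c • y c from
    (Finset.sum_filter_of_ne fun c _ h => left_ne_zero_of_smul h).symm]
  refine (convex_convexHull ℝ _).sum_mem (fun c _ => hw.1 c) ?_ fun c hc =>
    subset_convexHull ℝ _ (hsupp c (Finset.mem_filter.1 hc).2)
  rw [Finset.sum_filter_ne_zero]
  exact hw.2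

theorem HasClosedGraphMV.isClosed_of_mem {E : Type*} [TopologicalSpace E] [SequentialSpace E]
    {S : Set E} {Q : E → Set E} (h : HasClosedGraphMV S Q)
    {a : E} (ha : a ∈ S) : IsClosed (Q a) :=
  IsSeqClosed.isClosed fun y b hy hb =>
    h (fun _ => a) y a b (fun _ => ha) ha tendsto_const_nhds hy hb

/-- **Kakutani–Fan–Glicksberg fixed point theorem** in a normed space. -/
theorem HasClosedGraphMV.exists_mem_of_isCompact {K : Set E} (hK : IsCompact K)
    (hKc : Convex ℝ K) (hKne : K.Nonempty) {T : E → Set E} (hgraph : HasClosedGraphMV K T)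
    (hT : ∀ x ∈ K, (T x).Nonempty) (hTc : ∀ x ∈ K, Convex ℝ (T x)) (hTK : ∀ x ∈ K, T x ⊆ K) :
    ∃ x ∈ K, x ∈ T x := by
  choose x hxK hx using fun m : ℕ =>
    exists_mem_convexHull_biUnion_ball hK hKc hKne hT hTK (Nat.one_div_pos_of_nat (α := ℝ) (n := m))
  obtain ⟨z, hz, ψ, hψ, hlim⟩ := hK.tendsto_subseq hxK
  refine ⟨z, hz, ?_⟩
  rw [← (hgraph.isClosed_of_mem hz).closure_eq, Metric.mem_closure_iff_infDist_zero (hT z hz)]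
  have husc : ∀ δ > 0, ∃ m : ℕ, ∀ u ∈ K, dist u z < 1 / ((m : ℝ) + 1) →
      T u ⊆ Metric.thickening δ (T z) := by
    intro δ hδ
    by_contra! h
    choose u huK huz hu using h
    choose v hvT hv using fun m => not_subset.1 (hu m)
    obtain ⟨b, -, χ, hχ, hb⟩ := hK.tendsto_subseq fun m => hTK _ (huK m) (hvT m)
    have hut : Tendsto u atTop (𝓝 z) :=
      tendsto_iff_dist_tendsto_zero.2 (squeeze_zero (fun _ => dist_nonneg)
        (fun m => (huz m).le) tendsto_one_div_add_atTop_nhds_zero_nat)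
    have hbT : b ∈ T z := hgraph (u ∘ χ) (v ∘ χ) z b (fun m => huK _) hz
      (hut.comp hχ.tendsto_atTop) (fun m => hvT _) hb
    obtain ⟨m, hm⟩ := (hb.eventually (Metric.isOpen_thickening.mem_nhds
      (Metric.self_subset_thickening hδ _ hbT))).exists
    exact hv _ hm
  have hthick : ∀ δ > 0, z ∈ Metric.cthickening δ (T z) := by
    intro δ hδ
    obtain ⟨k, hk⟩ := husc δ hδ
    have hη : (0 : ℝ) < 1 / ((k : ℝ) + 1) / 2 := by positivity
    refine Metric.isClosed_cthickening.mem_of_tendsto hlim ?_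
    filter_upwards [hlim.eventually (Metric.ball_mem_nhds z hη),
      (tendsto_one_div_add_atTop_nhds_zero_nat.comp hψ.tendsto_atTop).eventually_lt_const hη]
      with m hm1 hm2
    refine Metric.thickening_subset_cthickening _ _
      (convexHull_min (iUnion₂_subset fun u hu => hk u hu.1 ?_) ((hTc z hz).thickening δ) (hx (ψ m)))
    have h1 : dist (x (ψ m)) z < 1 / ((k : ℝ) + 1) / 2 := hm1
    have h2 : 1 / (((ψ m : ℕ) : ℝ) + 1) < 1 / ((k : ℝ) + 1) / 2 := hm2
    have h3 : dist u (x (ψ m)) < 1 / (((ψ m : ℕ) : ℝ) + 1) := hu.2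
    have := dist_triangle u (x (ψ m)) z
    linarith
  refine le_antisymm (le_of_forall_pos_le_add fun δ hδ => ?_) Metric.infDist_nonneg
  rw [zero_add]
  have := hthick δ hδ
  rw [Metric.mem_cthickening_iff] at this
  exact ENNReal.toReal_le_of_le_ofReal hδ.le this

end Kakutani

section Krasnoselskii

variable {E : Type*} [NormedAddCommGroup E] [NormedSpace ℝ E]

/-- For every point `x₀` some closed convex set is generated by `x₀` and its own image. -/
theorem exists_eq_closure_convexHull_insert (T : E → Set E) (x₀ : E) :
    ∃ D : Set E, D = closure (convexHull ℝ (insert x₀ (⋃ x ∈ D, T x))) := by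
  let P : Set (Set E) := {D | IsClosed D ∧ Convex ℝ D ∧ x₀ ∈ D ∧ ∀ x ∈ D, T x ⊆ D}
  have hle : ∀ D ∈ P, closure (convexHull ℝ (insert x₀ (⋃ x ∈ ⋂₀ P, T x))) ⊆ D := fun D hD =>
    closure_minimal (convexHull_min (insert_subset hD.2.2.1
      (iUnion₂_subset fun x hx => hD.2.2.2 x (hx D hD))) hD.2.1) hD.1
  have hsub : insert x₀ (⋃ x ∈ ⋂₀ P, T x) ⊆
      closure (convexHull ℝ (insert x₀ (⋃ x ∈ ⋂₀ P, T x))) :=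
    (subset_convexHull ℝ _).trans subset_closure
  refine ⟨⋂₀ P, (sInter_subset_of_mem ?_).antisymm (subset_sInter hle)⟩
  refine ⟨isClosed_closure, (convex_convexHull ℝ _).closure, hsub (mem_insert _ _), fun x hx => ?_⟩
  exact (subset_iUnion₂_of_subset x (subset_sInter hle hx) Subset.rfl).trans
    ((subset_insert _ _).trans hsub)

/-- A point below its image under a monotone map with vanishing iterates is zero. -/
theorem eq_zero_of_le_of_tendsto_iterate {n : ℕ} {φ : (Fin n → ℝ≥0) → Fin n → ℝ≥0}
    (hφ : Monotone φ) {t : Fin n → ℝ≥0} (hlim : Tendsto (fun m => φ^[m] t) atTop (𝓝 0))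
    (ht : t ≤ φ t) : t = 0 := by
  have h : ∀ m, t ≤ φ^[m] t := fun m => by
    induction m with
    | zero => exact le_rfl
    | succ m ih =>
      rw [Function.iterate_succ_apply']
      exact ht.trans (hφ ih)
  exact le_antisymm (ge_of_tendsto' hlim h) fun i => zero_le

/-- A bounded set whose measure of noncompactness does not exceed that of its image under a
`φ`-contractive multivalued map is relatively compact. -/
theorem isCompact_closure_of_le_image {E : Type*} [SeminormedAddCommGroup E] {n : ℕ}
    {μ : Set E → Fin n → ℝ≥0∞}
    (hμ_real : ∀ V : Set E, IsBounded V → ∀ i, μ V i ≠ ⊤)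
    (hμ_reg : ∀ V : Set E, (∀ i, μ V i = 0) ↔ IsCompact (closure V))
    {F : E → Set E} {φ : (Fin n → ℝ≥0) → Fin n → ℝ≥0} (hφ_mono : Monotone φ)
    (hφ_iter : ∀ t : Fin n → ℝ≥0, Tendsto (fun m => φ^[m] t) atTop (𝓝 0))
    (hcontr : ∀ V : Set E, IsBounded V →
      ∀ i, μ (⋃ x ∈ V, F x) i ≤ (φ (fun j => (μ V j).toNNReal) i : ℝ≥0∞))
    {V : Set E} (hV : IsBounded V) (hle : ∀ i, μ V i ≤ μ (⋃ x ∈ V, F x) i) :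
    IsCompact (closure V) := by
  have h0 := eq_zero_of_le_of_tendsto_iterate hφ_mono (hφ_iter fun j => (μ V j).toNNReal)
    fun i => by
      rw [← ENNReal.coe_le_coe, ENNReal.coe_toNNReal (hμ_real V hV i)]
      exact (hle i).trans (hcontr V hV i)
  refine (hμ_reg V).1 fun i => ?_
  rw [← ENNReal.coe_toNNReal (hμ_real V hV i), ENNReal.coe_eq_zero]
  exact congrFun h0 i

/-- A bounded `φ`-contractive multivalued map has a fixed point, also after a translation. -/
theorem exists_mem_add_singleton {n : ℕ} {μ : Set E → Fin n → ℝ≥0∞}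
    (hμ_hull : ∀ V : Set E, V.Nonempty → μ (closure (convexHull ℝ V)) = μ V)
    (hμ_mono : ∀ V₁ V₂ : Set E, V₁ ⊆ V₂ → ∀ i, μ V₁ i ≤ μ V₂ i)
    (hμ_real : ∀ V : Set E, IsBounded V → ∀ i, μ V i ≠ ⊤)
    (hμ_reg : ∀ V : Set E, (∀ i, μ V i = 0) ↔ IsCompact (closure V))
    (hμ_add : ∀ V₁ V₂ : Set E, V₁.Nonempty → V₂.Nonempty →
      ∀ i, μ (V₁ + V₂) i ≤ μ V₁ i + μ V₂ i)
    {F : E → Set E} (hFne : ∀ x, (F x).Nonempty) (hFc : ∀ x, Convex ℝ (F x))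
    (hFgraph : HasClosedGraphMV Set.univ F)
    {φ : (Fin n → ℝ≥0) → Fin n → ℝ≥0} (hφ_mono : Monotone φ)
    (hφ_iter : ∀ t : Fin n → ℝ≥0, Tendsto (fun m => φ^[m] t) atTop (𝓝 0))
    (hcontr : ∀ V : Set E, IsBounded V →
      ∀ i, μ (⋃ x ∈ V, F x) i ≤ (φ (fun j => (μ V j).toNNReal) i : ℝ≥0∞))
    (hFE : IsBounded (⋃ x : E, F x)) (z : E) :
    ∃ x, x ∈ F x + {z} := by
  let T : E → Set E := fun x => F x + {z}
  have hTmem : ∀ x y, y ∈ T x ↔ y - z ∈ F x := fun x y => by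
    simp only [T, add_singleton, mem_image]
    exact ⟨by rintro ⟨u, hu, rfl⟩; simpa using hu, fun h => ⟨_, h, by simp⟩⟩
  obtain ⟨D, hD⟩ := exists_eq_closure_convexHull_insert T 0
  have hsub : insert 0 (⋃ x ∈ D, T x) ⊆ D := by
    conv_rhs => rw [hD]
    exact (subset_convexHull ℝ _).trans subset_closure
  have hD0 : (0 : E) ∈ D := hsub (mem_insert _ _)
  have hTD : (⋃ x ∈ D, T x) = (⋃ x ∈ D, F x) + {z} := by
    simp only [T, iUnion_add]
  have hFDne : (⋃ x ∈ D, F x).Nonempty := by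
    obtain ⟨u, hu⟩ := hFne 0
    exact ⟨u, mem_iUnion₂.2 ⟨0, hD0, hu⟩⟩
  have hDcl : IsClosed D := hD ▸ isClosed_closure
  have hDc : Convex ℝ D := by
    rw [hD]; exact (convex_convexHull ℝ _).closure
  have hDbd : IsBounded D := by
    rw [hD]
    refine (isBounded_convexHull.2 (isBounded_insert.2 ?_)).closure
    rw [hTD]
    exact (hFE.subset (iUnion₂_subset fun x _ => subset_iUnion F x)).add isBounded_singleton
  have hDcpt : IsCompact D := by
    rw [← hDcl.closure_eq]
    refine isCompact_closure_of_le_image hμ_real hμ_reg hφ_mono hφ_iter hcontr hDbd fun i => ?_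
    obtain ⟨u, hu⟩ := hFDne
    have hfin : ∀ i, μ {z, -u} i = 0 :=
      (hμ_reg _).2 ((Set.toFinite _).isCompact.closure)
    calc μ D i = μ (insert 0 (⋃ x ∈ D, T x)) i := by
          conv_lhs => rw [hD]
          rw [hμ_hull _ ⟨0, mem_insert _ _⟩]
      _ ≤ μ ((⋃ x ∈ D, F x) + {z, -u}) i := by
          have h0 : (0 : E) ∈ (⋃ x ∈ D, F x) + {z, -u} :=
            mem_add.2 ⟨u, hu, -u, by simp, add_neg_cancel u⟩
          refine hμ_mono _ _ (insert_subset h0 ?_) i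
          rw [hTD]
          exact add_subset_add_left (by simp)
      _ ≤ μ (⋃ x ∈ D, F x) i + μ {z, -u} i := hμ_add _ _ ⟨u, hu⟩ (insert_nonempty _ _) i
      _ = μ (⋃ x ∈ D, F x) i := by rw [hfin, add_zero]
  obtain ⟨x, -, hx⟩ := HasClosedGraphMV.exists_mem_of_isCompact hDcpt hDc ⟨0, hD0⟩ (T := T)
    (fun x y a b _ _ hxa hy hyb => (hTmem _ _).2 (hFgraph x (fun m => y m - z) a (b - z)
      (fun _ => mem_univ _) (mem_univ _) hxa (fun m => (hTmem _ _).1 (hy m)) (hyb.sub_const z)))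
    (fun x _ => (hFne x).add (singleton_nonempty z))
    (fun x _ => (hFc x).add (convex_singleton z))
    (fun x hx => (subset_iUnion₂_of_subset x hx Subset.rfl).trans
      ((subset_insert _ _).trans hsub))
  exact ⟨x, hx⟩

/-- The Krasnoselskii-type theorem for a normed space. -/
theorem krasnoselskii_multivalued {n : ℕ} {S : Set E} (hS : S.Nonempty) (hSbd : IsBounded S)
    (hScl : IsClosed S) (hScv : Convex ℝ S) {μ : Set E → Fin n → ℝ≥0∞}
    (hμ_hull : ∀ V : Set E, V.Nonempty → μ (closure (convexHull ℝ V)) = μ V)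
    (hμ_mono : ∀ V₁ V₂ : Set E, V₁ ⊆ V₂ → ∀ i, μ V₁ i ≤ μ V₂ i)
    (hμ_real : ∀ V : Set E, IsBounded V → ∀ i, μ V i ≠ ⊤)
    (hμ_reg : ∀ V : Set E, (∀ i, μ V i = 0) ↔ IsCompact (closure V))
    (hμ_add : ∀ V₁ V₂ : Set E, V₁.Nonempty → V₂.Nonempty →
      ∀ i, μ (V₁ + V₂) i ≤ μ V₁ i + μ V₂ i)
    {F G : E → Set E} (hFne : ∀ x, (F x).Nonempty) (hFc : ∀ x, Convex ℝ (F x))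
    (hGne : ∀ x ∈ S, (G x).Nonempty)
    (hFgraph : HasClosedGraphMV Set.univ F) (hGgraph : HasClosedGraphMV S G)
    {φ : (Fin n → ℝ≥0) → Fin n → ℝ≥0} (hφ_mono : Monotone φ)
    (hφ_iter : ∀ t : Fin n → ℝ≥0, Tendsto (fun m => φ^[m] t) atTop (𝓝 0))
    (hcontr : ∀ V : Set E, IsBounded V →
      ∀ i, μ (⋃ x ∈ V, F x) i ≤ (φ (fun j => (μ V j).toNNReal) i : ℝ≥0∞))
    (hFE : IsBounded (⋃ x : E, F x)) (hGS : IsCompact (closure (⋃ x ∈ S, G x)))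
    (hconv : ∀ x ∈ S, Convex ℝ {y : E | (((fun u => y - u) '' F y) ∩ G x).Nonempty})
    (hinv : ∀ x y : E, y ∈ S → x ∈ F x + G y → x ∈ S) :
    ∃ x ∈ S, x ∈ F x + G x := by
  let H : E → Set E := fun x => {y : E | (((fun u => y - u) '' F y) ∩ G x).Nonempty}
  have hH : ∀ x y, y ∈ H x ↔ y ∈ F y + G x := fun x y => by
    constructor
    · rintro ⟨_, ⟨u, hu, rfl⟩, hg⟩
      exact ⟨u, hu, _, hg, by simp⟩
    · rintro ⟨u, hu, v, hv, huv⟩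
      exact ⟨v, ⟨u, hu, by simp [← huv]⟩, hv⟩
  have hHne : ∀ x ∈ S, (H x).Nonempty := fun x hx => by
    obtain ⟨g, hg⟩ := hGne x hx
    obtain ⟨y, hy⟩ := exists_mem_add_singleton hμ_hull hμ_mono hμ_real hμ_reg hμ_add hFne hFc
      hFgraph hφ_mono hφ_iter hcontr hFE g
    exact ⟨y, (hH x y).2 (add_subset_add_left (singleton_subset_iff.2 hg) hy)⟩
  let A : Set E := ⋃ x ∈ S, H x
  have hAS : A ⊆ S := iUnion₂_subset fun x hx y hy => hinv y x hx ((hH x y).1 hy)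
  have hAne : A.Nonempty := by
    obtain ⟨x, hx⟩ := hS
    obtain ⟨y, hy⟩ := hHne x hx
    exact ⟨y, mem_iUnion₂.2 ⟨x, hx, hy⟩⟩
  have hA : IsCompact (closure A) := by
    refine isCompact_closure_of_le_image hμ_real hμ_reg hφ_mono hφ_iter hcontr
      (hSbd.subset hAS) fun i => ?_
    have hsub : A ⊆ (⋃ x ∈ A, F x) + ⋃ x ∈ S, G x := fun y hy => by
      obtain ⟨x, hx, hyx⟩ := mem_iUnion₂.1 hy
      obtain ⟨u, hu, v, hv, huv⟩ := (hH x y).1 hyx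
      exact ⟨u, mem_iUnion₂.2 ⟨y, hy, hu⟩, v, mem_iUnion₂.2 ⟨x, hx, hv⟩, huv⟩
    have hne := hAne.mono hsub
    calc μ A i ≤ μ ((⋃ x ∈ A, F x) + ⋃ x ∈ S, G x) i := hμ_mono _ _ hsub i
      _ ≤ μ (⋃ x ∈ A, F x) i + μ (⋃ x ∈ S, G x) i :=
          hμ_add _ _ (add_nonempty.1 hne).1 (add_nonempty.1 hne).2 i
      _ = μ (⋃ x ∈ A, F x) i := by rw [(hμ_reg _).2 hGS i, add_zero]
  have hK : IsCompact (closure (convexHull ℝ A)) := by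
    refine (hμ_reg _).1 fun i => ?_
    rw [← hμ_hull _ hAne.convexHull, (convex_convexHull ℝ A).convexHull_eq, hμ_hull A hAne]
    exact (hμ_reg A).2 hA i
  have hKS : closure (convexHull ℝ A) ⊆ S := closure_minimal (convexHull_min hAS hScv) hScl
  have hgraph : HasClosedGraphMV (closure (convexHull ℝ A)) H := by
    intro x y a b hx ha hxa hy hyb
    choose u hu v hv huv using fun m => (hH _ _).1 (hy m)
    obtain ⟨c, -, χ, hχ, hc⟩ := hGS.tendsto_subseq fun m =>
      subset_closure (mem_iUnion₂.2 ⟨x m, hKS (hx m), hv m⟩)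
    have hcG : c ∈ G a := hGgraph (x ∘ χ) (v ∘ χ) a c (fun m => hKS (hx _)) (hKS ha)
      (hxa.comp hχ.tendsto_atTop) (fun m => hv _) hc
    have hbF : b - c ∈ F b := hFgraph (y ∘ χ) (u ∘ χ) b (b - c) (fun _ => mem_univ _) (mem_univ _)
      (hyb.comp hχ.tendsto_atTop) (fun m => hu _)
      (((hyb.comp hχ.tendsto_atTop).sub hc).congr fun m => by simp [← huv])
    exact (hH _ _).2 ⟨b - c, hbF, c, hcG, by simp⟩
  obtain ⟨x, hx, hxH⟩ := hgraph.exists_mem_of_isCompact hK (convex_convexHull ℝ A).closure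
    hAne.convexHull.closure (fun x hx => hHne x (hKS hx)) (fun x hx => hconv x (hKS hx))
    (fun x hx => (subset_iUnion₂_of_subset x (hKS hx) Subset.rfl).trans
      ((subset_convexHull ℝ A).trans subset_closure))
  exact ⟨x, hKS hx, (hH x x).1 hxH⟩

end Krasnoselskii

/-- Krasnoselskii-type theorem.  `S` is a nonempty bounded closed convex
subset of a generalized Banach space `E`, `μ` a monotone, regular, real, lower-additive
generalized measure of noncompactness; `F` is defined on all of `E` with closed graph and
nonempty closed convex values, `G` on `S` with closed graph and nonempty values;
`μ(F(V)) ≤ φ(μ(V))` for bounded `V ⊆ E`; `F(E)` is bounded and `G(S)` relatively compact;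
`(I−F)⁻¹G(x)` is convex for `x ∈ S`; and `x ∈ F x + G y` with `y ∈ S` forces `x ∈ S`.
Then `x ∈ F x + G x` for some `x ∈ S`. -/
theorem stmt_7
    {E : Type*} [AddCommGroup E] [Module ℝ E] [MetricSpace E] [CompleteSpace E]
    {n : ℕ} (hn : 1 ≤ n) (N : Fin n → E → ℝ)
    (hN_nonneg : ∀ i x, 0 ≤ N i x)
    (hN_triangle : ∀ i (x y : E), N i (x + y) ≤ N i x + N i y)
    (hN_smul : ∀ i (a : ℝ) (x : E), N i (a • x) = |a| * N i x)
    (hN_zero : ∀ i (x : E), N i x = 0 → x = 0)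
    (hdist : ∀ x y : E, dist x y = ⨆ i, N i (x - y))
    (S : Set E) (hS : S.Nonempty) (hSbd : IsBounded S) (hScl : IsClosed S)
    (hScv : Convex ℝ S)
    (μ : Set E → Fin n → ℝ≥0∞)
    (hμ_hull : ∀ V : Set E, V.Nonempty → μ (closure (convexHull ℝ V)) = μ V)
    (hμ_mono : ∀ V₁ V₂ : Set E, V₁ ⊆ V₂ → ∀ i, μ V₁ i ≤ μ V₂ i)
    (hμ_real : ∀ V : Set E, IsBounded V → ∀ i, μ V i ≠ ⊤)
    (hμ_reg : ∀ V : Set E, (∀ i, μ V i = 0) ↔ IsCompact (closure V))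
    (hμ_add : ∀ V₁ V₂ : Set E, V₁.Nonempty → V₂.Nonempty →
      ∀ i, μ (V₁ + V₂) i ≤ μ V₁ i + μ V₂ i)
    (F G : E → Set E)
    (hFval : ∀ x : E, (F x).Nonempty ∧ IsClosed (F x) ∧ Convex ℝ (F x))
    (hGval : ∀ x ∈ S, (G x).Nonempty)
    (hFgraph : HasClosedGraphMV Set.univ F)
    (hGgraph : HasClosedGraphMV S G)
    (φ : (Fin n → ℝ≥0) → (Fin n → ℝ≥0))
    (hφ_cont : Continuous φ) (hφ_mono : Monotone φ)
    (hφ_iter : ∀ t : Fin n → ℝ≥0, Tendsto (fun m => φ^[m] t) atTop (nhds 0))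
    (hcontr : ∀ V : Set E, IsBounded V →
      ∀ i, μ (⋃ x ∈ V, F x) i ≤ (φ (fun j => (μ V j).toNNReal) i : ℝ≥0∞))
    (hFE : IsBounded (⋃ x : E, F x))
    (hGS : IsCompact (closure (⋃ x ∈ S, G x)))
    (hconv : ∀ x ∈ S, Convex ℝ {y : E | (((fun u => y - u) '' F y) ∩ G x).Nonempty})
    (hinv : ∀ x y : E, y ∈ S → x ∈ F x + G y → x ∈ S) :
    ∃ x ∈ S, x ∈ F x + G x := by
  have hsup_neg : ∀ x y : E, dist x y = dist (x - y) 0 := fun x y => by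
    simp only [hdist, sub_zero]
  let _ : NormedAddCommGroup E :=
    { ‹AddCommGroup E›, ‹MetricSpace E› with
      norm := fun x => dist x 0
      dist_eq := fun x y => by
        rw [dist_comm, hsup_neg]
        exact congrArg (fun t => dist t 0) (by abel) }
  let _ : NormedSpace ℝ E :=
    { ‹Module ℝ E› with
      norm_smul_le := fun a x => by
        change dist (a • x) 0 ≤ |a| * dist x 0
        simp only [hdist, sub_zero, hN_smul]
        exact (Real.mul_iSup_of_nonneg (abs_nonneg a) _).ge }
  exact krasnoselskii_multivalued hS hSbd hScl hScv hμ_hull hμ_mono hμ_real hμ_reg hμ_add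
    (fun x => (hFval x).1) (fun x => (hFval x).2.2) hGval hFgraph hGgraph hφ_mono hφ_iter hcontr
    hFE hGS hconv hinv
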